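/- arXiv:2503.18980 — 4 statements merged into one kernel-verified Lean document; each statement's English description precedes it below -/
import Mathlib

section
/- Regret decomposition for one episode (Lemma B.1): Fix an episode with realized trajectory s_1, ..., s_{H+1} ∈ S and a_1, ..., a_H ∈ A, an executed policy π' = (π'_h)_{h=1}^H, a comparator policy π* = (π*_h)_{h=1}^H, and for each h ∈ {1,...,H+1} an arbitrary function Q^e_h : S × A → ℝ with Q^e_{H+1} ≡ 0; set V^e_h(s) := Σ_{a∈A} π'_h(s)(a) · Q^e_h(s,a). Define, for h ∈ {1,...,H}: the temporal-difference error δ_h(s,a) := r_h(s,a) + Σ_{s'∈S} P_h(s,a)(s') · V^e_{h+1}(s') − Q^e_h(s,a); ζ_h := [V^e_h(s_h) − V^{π'}_h(s_h)] − [Q^e_h(s_h,a_h) − Q^{π'}_h(s_h,a_h)]; ε_h := Σ_{s'∈S} P_h(s_h,a_h)(s') · [V^e_{h+1}(s') − V^{π'}_{h+1}(s')] − [V^e_{h+1}(s_{h+1}) − V^{π'}_{h+1}(s_{h+1})]. Then V^{π*}_1(s_1) − V^{π'}_1(s_1) = Σ_{h=1}^H ( E_{π*}[ δ_h(s_h,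 a_h) | s_1 ] − δ_h(s_h, a_h) ) + Σ_{h=1}^H (ζ_h + ε_h) + Σ_{h=1}^H E_{π*}[ Σ_{a∈A} Q^e_h(s_h, a) · (π*_h(s_h)(a) − π'_h(s_h)(a)) | s_1 ], where in the first and third sums (s_h, a_h) denote the random state-action pair at step h of the trajectory started at s_1 with a_t sampled from π*_t(s_t) and s_{t+1} sampled from P_t(s_t, a_t), and E_{π*}[· | s_1] is the expectation under this trajectory distribution. -/
open Finset

section RegretDecomposition

variable {S A : Type*}

/-- `Qaux H P r π k` is the action-value function `Q^π_h` of policy `π` in the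
finite-horizon MDP with horizon `H`, transitions `P`, rewards `r`, at step
`h = H + 1 - k` (so `k` is the number of remaining steps, and `Qaux H P r π 0 = 0`
is the value `Q^π_{H+1} ≡ 0`). -/
noncomputable def Qaux [Fintype S] [Fintype A]
    (H : ℕ) (P : ℕ → S → A → PMF S) (r : ℕ → S → A → ℝ)
    (π : ℕ → S → PMF A) : ℕ → S → A → ℝ
  | 0 => fun _ _ => 0
  | k + 1 => fun s a =>
      r (H - k) s a + ∑ s' : S, (P (H - k) s a s').toReal *
        ∑ a' : A, (π (H + 1 - k) s' a').toReal * Qaux H P r π k s' a'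

/-- `Qpol H P r π h` is the action-value function `Q^π_h` (for `1 ≤ h ≤ H + 1`). -/
noncomputable def Qpol [Fintype S] [Fintype A]
    (H : ℕ) (P : ℕ → S → A → PMF S) (r : ℕ → S → A → ℝ)
    (π : ℕ → S → PMF A) (h : ℕ) : S → A → ℝ :=
  Qaux H P r π (H + 1 - h)

/-- `Vpol H P r π h` is the state-value function `V^π_h(s) = Σ_a π_h(s)(a) Q^π_h(s,a)`. -/
noncomputable def Vpol [Fintype S] [Fintype A]
    (H : ℕ) (P : ℕ → S → A → PMF S) (r : ℕ → S → A → ℝ)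
    (π : ℕ → S → PMF A) (h : ℕ) (x : S) : ℝ :=
  ∑ b : A, (π h x b).toReal * Qpol H P r π h x b

/-- `Etraj P π t n s f` is the expectation `E_π[f(s_{t+n}, a_{t+n}) | s_t = s]` of
`f` evaluated at the random state-action pair at step `t + n` of the trajectory
started at state `s` at step `t`, where actions are drawn from `π` and successor
states from `P`. -/
noncomputable def Etraj [Fintype S] [Fintype A]
    (P : ℕ → S → A → PMF S) (π : ℕ → S → PMF A) :
    ℕ → ℕ → S → (S → A → ℝ) → ℝ
  | t, 0, s, f => ∑ a : A, (π t s a).toReal * f s a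
  | t, n + 1, s, f => ∑ a : A, (π t s a).toReal *
      ∑ s' : S, (P t s a s').toReal * Etraj P π (t + 1) n s' f

lemma sum_toReal_one [Fintype A] (p : PMF A) : ∑ b : A, (p b).toReal = 1 := by
  rw [← ENNReal.toReal_sum (fun b _ => p.apply_ne_top b)]
  have h := p.tsum_coe
  rw [tsum_fintype] at h
  rw [h]
  simp

lemma Qpol_bellman [Fintype S] [Fintype A]
    (H : ℕ) (P : ℕ → S → A → PMF S) (r : ℕ → S → A → ℝ)
    (π : ℕ → S → PMF A) (h : ℕ) (hh : h ≤ H) (x : S) (b : A) :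
    Qpol H P r π h x b =
      r h x b + ∑ x' : S, (P h x b x').toReal * Vpol H P r π (h + 1) x' := by
  obtain ⟨k, rfl⟩ := Nat.exists_eq_add_of_le hh
  have e1 : h + k + 1 - h = k + 1 := by omega
  have e2 : h + k - k = h := by omega
  have e3 : h + k + 1 - k = h + 1 := by omega
  have e4 : h + k + 1 - (h + 1) = k := by omega
  simp only [Qpol, Vpol, e1, e4, Qaux, e2, e3]

lemma Etraj_add [Fintype S] [Fintype A]
    (P : ℕ → S → A → PMF S) (π : ℕ → S → PMF A) (n : ℕ) (f g : S → A → ℝ) :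
    ∀ (t : ℕ) (x : S), Etraj P π t n x (fun y b => f y b + g y b) =
      Etraj P π t n x f + Etraj P π t n x g := by
  induction n with
  | zero => intro t x; simp only [Etraj, mul_add, Finset.sum_add_distrib]
  | succ n ih => intro t x; simp only [Etraj, ih, mul_add, Finset.sum_add_distrib]

lemma value_diff [Fintype S] [Fintype A]
    (H : ℕ) (P : ℕ → S → A → PMF S) (r : ℕ → S → A → ℝ)
    (π' πstar : ℕ → S → PMF A)
    (Qe : ℕ → S → A → ℝ) (hQe : ∀ x b, Qe (H + 1) x b = 0)
    (Ve : ℕ → S → ℝ)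
    (hVe : ∀ h x, Ve h x = ∑ b : A, (π' h x b).toReal * Qe h x b)
    (δ : ℕ → S → A → ℝ)
    (hδ : ∀ h ∈ Finset.Icc 1 H, ∀ x b, δ h x b =
      r h x b + (∑ x' : S, (P h x b x').toReal * Ve (h + 1) x') - Qe h x b)
    (n : ℕ) : ∀ (t : ℕ) (_ : 1 ≤ t) (_ : t + n = H + 1) (x : S),
    Vpol H P r πstar t x - Ve t x = ∑ i ∈ Finset.range n,
      Etraj P πstar t i x (fun y c => δ (t + i) y c + ∑ b : A,
        Qe (t + i) y b * ((πstar (t + i) y b).toReal - (π' (t + i) y b).toReal)) := by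
  induction n with
  | zero =>
    intro t _ h2 x
    obtain rfl : t = H + 1 := by omega
    simp [hVe, hQe, Vpol, Qpol, Qaux]
  | succ n ih =>
    intro t h1 h2 x
    have hstep : ∀ i, t + (i + 1) = t + 1 + i := fun i => by omega
    rw [Finset.sum_range_succ', Finset.sum_congr rfl (fun i _ => by rw [hstep i])]
    simp only [Etraj]
    rw [Finset.sum_comm]
    simp only [← Finset.mul_sum]
    have key : ∀ b : A, (∑ i ∈ Finset.range n, ∑ x' : S, (P t x b x').toReal *
        Etraj P πstar (t + 1) i x' (fun y c => δ (t + 1 + i) y c + ∑ b : A,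
        Qe (t + 1 + i) y b * ((πstar (t + 1 + i) y b).toReal - (π' (t + 1 + i) y b).toReal)))
        = Qpol H P r πstar t x b - Qe t x b - δ t x b := by
      intro b
      rw [Finset.sum_comm]
      simp only [← Finset.mul_sum]
      rw [Qpol_bellman H P r πstar t (by omega), hδ t (Finset.mem_Icc.2 ⟨h1, by omega⟩)]
      simp only [← ih (t + 1) (by omega) (by omega)]
      simp only [mul_sub, Finset.sum_sub_distrib]
      ring
    simp only [key]
    simp only [add_zero, mul_add, mul_sub, Finset.sum_add_distrib, Finset.sum_sub_distrib,
      ← Finset.sum_mul, sum_toReal_one, one_mul, hVe, Vpol]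
    simp only [mul_comm (Qe _ _ _)]
    ring

/-- Regret decomposition for one episode (Lemma B.1):
`V^{π*}_1(s_1) − V^{π'}_1(s_1)` decomposes into the expected-minus-realized
temporal-difference errors, the stochastic terms `ζ_h + ε_h`, and the expected
advantage of `π*` over `π'` with respect to the estimated values `Q^e`. -/
theorem regret_decomposition [Fintype S] [Fintype A] [Nonempty S] [Nonempty A]
    (H : ℕ) (hH : 1 ≤ H)
    (P : ℕ → S → A → PMF S) (r : ℕ → S → A → ℝ)
    (π' πstar : ℕ → S → PMF A)
    (s : ℕ → S) (a : ℕ → A)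
    (Qe : ℕ → S → A → ℝ) (hQe : ∀ x b, Qe (H + 1) x b = 0)
    (Ve : ℕ → S → ℝ)
    (hVe : ∀ h x, Ve h x = ∑ b : A, (π' h x b).toReal * Qe h x b)
    (δ : ℕ → S → A → ℝ)
    (hδ : ∀ h ∈ Finset.Icc 1 H, ∀ x b, δ h x b =
      r h x b + (∑ x' : S, (P h x b x').toReal * Ve (h + 1) x') - Qe h x b)
    (ζ ε : ℕ → ℝ)
    (hζ : ∀ h ∈ Finset.Icc 1 H, ζ h =
      (Ve h (s h) - Vpol H P r π' h (s h)) -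
        (Qe h (s h) (a h) - Qpol H P r π' h (s h) (a h)))
    (hε : ∀ h ∈ Finset.Icc 1 H, ε h =
      (∑ x' : S, (P h (s h) (a h) x').toReal *
          (Ve (h + 1) x' - Vpol H P r π' (h + 1) x')) -
        (Ve (h + 1) (s (h + 1)) - Vpol H P r π' (h + 1) (s (h + 1)))) :
    Vpol H P r πstar 1 (s 1) - Vpol H P r π' 1 (s 1) =
      (∑ h ∈ Finset.Icc 1 H,
          (Etraj P πstar 1 (h - 1) (s 1) (δ h) - δ h (s h) (a h)))
        + (∑ h ∈ Finset.Icc 1 H, (ζ h + ε h))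
        + ∑ h ∈ Finset.Icc 1 H,
            Etraj P πstar 1 (h - 1) (s 1)
              (fun x _ => ∑ b : A,
                Qe h x b * ((πstar h x b).toReal - (π' h x b).toReal)) := by
  have h1 := value_diff H P r π' πstar Qe hQe Ve hVe δ hδ H 1 le_rfl (by omega) (s 1)
  have h2 : ∑ h ∈ Finset.Icc 1 H, (ζ h + ε h - δ h (s h) (a h)) =
      Ve 1 (s 1) - Vpol H P r π' 1 (s 1) := by
    have e : ∀ h ∈ Finset.Icc 1 H, ζ h + ε h - δ h (s h) (a h) =
        (Ve h (s h) - Vpol H P r π' h (s h)) -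
        (Ve (h + 1) (s (h + 1)) - Vpol H P r π' (h + 1) (s (h + 1))) := by
      intro h hh
      rw [hζ h hh, hε h hh, hδ h hh, Qpol_bellman H P r π' h (Finset.mem_Icc.1 hh).2]
      simp only [mul_sub, Finset.sum_sub_distrib]
      ring
    rw [Finset.sum_congr rfl e, ← Finset.Ico_add_one_right_eq_Icc, Finset.sum_Ico_eq_sum_range]
    have tel := Finset.sum_range_sub'
      (fun i => Ve (1 + i) (s (1 + i)) - Vpol H P r π' (1 + i) (s (1 + i))) H
    have hz : Ve (1 + H) (s (1 + H)) - Vpol H P r π' (1 + H) (s (1 + H)) = 0 := by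
      rw [add_comm 1 H]
      simp [hVe, hQe, Vpol, Qpol, Qaux]
    simp only [hz, add_zero, sub_zero] at tel
    rw [← tel]
    rfl
  have h3 : ∑ i ∈ Finset.range H, Etraj P πstar 1 i (s 1) (fun y c => δ (1 + i) y c + ∑ b : A,
        Qe (1 + i) y b * ((πstar (1 + i) y b).toReal - (π' (1 + i) y b).toReal)) =
      ∑ h ∈ Finset.Icc 1 H, (Etraj P πstar 1 (h - 1) (s 1) (δ h) +
            Etraj P πstar 1 (h - 1) (s 1)
              (fun x _ => ∑ b : A,
                Qe h x b * ((πstar h x b).toReal - (π' h x b).toReal))) := by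
    rw [← Finset.Ico_add_one_right_eq_Icc, Finset.sum_Ico_eq_sum_range]
    refine Finset.sum_congr rfl fun i _ => ?_
    rw [Nat.add_sub_cancel_left]
    exact Etraj_add P πstar i _ _ 1 (s 1)
  rw [h3, Finset.sum_add_distrib] at h1
  rw [Finset.sum_sub_distrib] at h2 ⊢
  linarith

end RegretDecomposition
end

section
/- Elliptical potential lemma (sum of squared bonuses): Let d, M ≥ 1 be integers and λ ≥ 1 a real number. Let φ_1, ..., φ_M ∈ ℝ^d satisfy ‖φ_m‖₂ ≤ 1 for all m, and define A_1 = λ I_d and A_{m+1} = A_m + φ_m φ_mᵀ for m = 1, ..., M. Then every A_m is symmetric positive definite, and Σ_{m=1}^M φ_mᵀ A_m^{-1} φ_m ≤ 2 d log(1 + M/(λ d)). -/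
open scoped Matrix

/-- The determinant of a positive definite matrix is controlled by its trace. -/
lemma ep_log_det_le {d : ℕ} (A : Matrix (Fin d) (Fin d) ℝ) (hA : A.PosDef) (t : ℝ) (ht : 0 < t)
    (htr : A.trace ≤ t * d) : Real.log A.det ≤ d * Real.log t := by
  have h1 : A.det = ∏ i, hA.1.eigenvalues i := by
    simpa using hA.1.det_eq_prod_eigenvalues
  have h2 : A.trace = ∑ i, hA.1.eigenvalues i := by
    simpa using hA.1.trace_eq_sum_eigenvalues
  rw [h1, Real.log_prod (fun i _ => (hA.eigenvalues_pos i).ne')]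
  have h3 : ∀ i ∈ Finset.univ, Real.log (hA.1.eigenvalues i) ≤
      Real.log t + (hA.1.eigenvalues i / t - 1) := by
    intro i _
    have hp := hA.eigenvalues_pos i
    have := Real.log_le_sub_one_of_pos (div_pos hp ht)
    rw [Real.log_div hp.ne' ht.ne'] at this
    linarith
  refine (Finset.sum_le_sum h3).trans ?_
  rw [Finset.sum_add_distrib, Finset.sum_sub_distrib, ← Finset.sum_div, ← h2]
  simp only [Finset.sum_const, Finset.card_univ, Fintype.card_fin, nsmul_eq_mul, mul_one]
  have : A.trace / t ≤ d := by
    rw [div_le_iff₀ ht]; linarith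
  linarith

lemma ep_bonus {d : ℕ} (A : Matrix (Fin d) (Fin d) ℝ) (hA : A.PosDef)
    (hA1 : (A - 1).PosSemidef) (v : Fin d → ℝ) (hv : v ⬝ᵥ v ≤ 1) :
    0 ≤ v ⬝ᵥ A⁻¹.mulVec v ∧ v ⬝ᵥ A⁻¹.mulVec v ≤ 1 := by
  have h0 : 0 ≤ v ⬝ᵥ A⁻¹.mulVec v := by
    simpa using hA.inv.posSemidef.dotProduct_mulVec_nonneg v
  refine ⟨h0, ?_⟩
  set y := A⁻¹.mulVec v with hy
  have hAy : A.mulVec y = v := by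
    rw [hy, Matrix.mulVec_mulVec, Matrix.mul_nonsing_inv _ hA.det_pos.ne'.isUnit,
      Matrix.one_mulVec]
  have h1 : 0 ≤ y ⬝ᵥ (A - 1).mulVec y := by
    simpa using hA1.dotProduct_mulVec_nonneg y
  rw [Matrix.sub_mulVec, Matrix.one_mulVec, hAy, dotProduct_sub, dotProduct_comm y v] at h1
  have hcs : (v ⬝ᵥ y) ^ 2 ≤ (v ⬝ᵥ v) * (y ⬝ᵥ y) := by
    have := Finset.sum_mul_sq_le_sq_mul_sq Finset.univ v y
    simpa [dotProduct, pow_two] using this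
  have hyy : 0 ≤ y ⬝ᵥ y := by
    simpa using dotProduct_star_self_nonneg y
  nlinarith

lemma ep_det {d : ℕ} (A : Matrix (Fin d) (Fin d) ℝ) (hA : A.PosDef) (v : Fin d → ℝ) :
    (A + Matrix.vecMulVec v v).det = A.det * (1 + v ⬝ᵥ A⁻¹.mulVec v) := by
  rw [Matrix.vecMulVec_eq Unit, Matrix.det_add_replicateCol_mul_replicateRow
    hA.det_pos.ne'.isUnit]
  simp [Matrix.det_unique, Matrix.mul_apply, Matrix.mulVec, dotProduct, Matrix.add_apply,
    Finset.mul_sum, Finset.sum_mul]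
  rw [Finset.sum_comm]
  simp [mul_assoc]

/-- Elliptical potential lemma (sum of squared bonuses): with `A_1 = λ I` and
`A_{m+1} = A_m + φ_m φ_mᵀ` for unit-norm vectors `φ_m`, every `A_m` is symmetric positive
definite and `Σ_{m=1}^M φ_mᵀ A_m⁻¹ φ_m ≤ 2 d log(1 + M/(λ d))`. -/
theorem elliptical_potential_sq {d M : ℕ} (hd : 1 ≤ d) (hM : 1 ≤ M)
    (lam : ℝ) (hlam : 1 ≤ lam)
    (φ : ℕ → Fin d → ℝ)
    (hφ : ∀ m ∈ Finset.Icc 1 M, Real.sqrt (∑ i, φ m i ^ 2) ≤ 1)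
    (A : ℕ → Matrix (Fin d) (Fin d) ℝ)
    (hA1 : A 1 = lam • (1 : Matrix (Fin d) (Fin d) ℝ))
    (hArec : ∀ m ∈ Finset.Icc 1 M, A (m + 1) = A m + Matrix.vecMulVec (φ m) (φ m)) :
    (∀ m ∈ Finset.Icc 1 (M + 1), (A m).PosDef) ∧
      ∑ m ∈ Finset.Icc 1 M, φ m ⬝ᵥ (A m)⁻¹.mulVec (φ m) ≤
        2 * d * Real.log (1 + M / (lam * d)) := by
  have hd0 : (0 : ℝ) < d := by exact_mod_cast hd
  have hl0 : 0 < lam := by linarith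
  have key : ∀ m, m ≤ M → (A (m + 1)).PosDef ∧ (A (m + 1) - 1).PosSemidef ∧
      (A (m + 1)).trace ≤ lam * d + m ∧
      ∑ k ∈ Finset.Icc 1 m, φ k ⬝ᵥ (A k)⁻¹.mulVec (φ k) ≤
        2 * (Real.log (A (m + 1)).det - d * Real.log lam) := by
    intro m
    induction m with
    | zero =>
      intro _
      have e : lam • (1 : Matrix (Fin d) (Fin d) ℝ) - 1
          = (lam - 1) • (1 : Matrix (Fin d) (Fin d) ℝ) := by rw [sub_smul, one_smul]
      simp only [zero_add, hA1]
      refine ⟨Matrix.PosDef.one.smul hl0, ?_, ?_, ?_⟩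
      · rw [e]
        exact Matrix.PosSemidef.one.smul (by linarith)
      · simp [Matrix.trace_smul]
      · simp [Matrix.det_smul, Real.log_pow]
    | succ m ih =>
      intro hm
      obtain ⟨hP, hS, hT, hsum⟩ := ih (by omega)
      have hmem : m + 1 ∈ Finset.Icc 1 M := by simp; omega
      have hr := hArec (m + 1) hmem
      have hn := hφ (m + 1) hmem
      have hv : φ (m + 1) ⬝ᵥ φ (m + 1) ≤ 1 := by
        rw [Real.sqrt_le_left zero_le_one, one_pow] at hn
        simpa [dotProduct, pow_two] using hn
      have hV : (Matrix.vecMulVec (φ (m + 1)) (φ (m + 1))).PosSemidef := by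
        simpa using Matrix.posSemidef_vecMulVec_self_star (φ (m + 1))
      obtain ⟨hx0, hx1⟩ := ep_bonus _ hP hS _ hv
      have hdet := ep_det _ hP (φ (m + 1))
      rw [hr]
      refine ⟨hP.add_posSemidef hV, ?_, ?_, ?_⟩
      · rw [add_sub_right_comm]
        exact hS.add hV
      · rw [Matrix.trace_add, Matrix.trace_vecMulVec]
        push_cast
        linarith
      · rw [hdet, Finset.sum_Icc_succ_top (by omega), Real.log_mul hP.det_pos.ne' (by linarith)]
        set x := φ (m + 1) ⬝ᵥ (A (m + 1))⁻¹.mulVec (φ (m + 1))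
        have h1 : 1 - (1 + x)⁻¹ ≤ Real.log (1 + x) :=
          Real.one_sub_inv_le_log_of_pos (by linarith)
        have h2 : x / 2 ≤ 1 - (1 + x)⁻¹ := by
          have : 1 - (1 + x)⁻¹ = x / (1 + x) := by
            have : 1 + x ≠ 0 := by linarith
            field_simp
            ring
          rw [this]
          exact div_le_div_of_nonneg_left hx0 (by linarith) (by linarith)
        linarith
  refine ⟨?_, ?_⟩
  · intro m hm
    rw [Finset.mem_Icc] at hm
    obtain ⟨k, rfl⟩ : ∃ k, m = k + 1 := ⟨m - 1, by omega⟩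
    exact (key k (by omega)).1
  · obtain ⟨hP, -, hT, hsum⟩ := key M le_rfl
    have ht : (0 : ℝ) < 1 + M / (lam * d) := by positivity
    have := ep_log_det_le _ hP (lam * (1 + M / (lam * d))) (by positivity) (by
      refine hT.trans (le_of_eq ?_)
      field_simp)
    rw [Real.log_mul hl0.ne' ht.ne'] at this
    linarith
end

section
/- Sum of exploration bonuses (corollary of the elliptical potential lemma): Let d, M ≥ 1 be integers and λ ≥ 1 a real number. Let φ_1, ..., φ_M ∈ ℝ^d satisfy ‖φ_m‖₂ ≤ 1 for all m, and define A_1 = λ I_d and A_{m+1} = A_m + φ_m φ_mᵀ for m = 1, ..., M. Then Σ_{m=1}^M √(φ_mᵀ A_m^{-1} φ_m) ≤ √(2 M d log(1 + M/(λ d))). -/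
open scoped Matrix

lemma aux_step {d : ℕ} (B : Matrix (Fin d) (Fin d) ℝ) (hB : (B - 1).PosSemidef) (v : Fin d → ℝ)
    (hv : Real.sqrt (∑ i, v i ^ 2) ≤ 1) :
    0 ≤ v ⬝ᵥ B⁻¹.mulVec v ∧
    v ⬝ᵥ B⁻¹.mulVec v ≤ 2 * (Real.log (B + Matrix.vecMulVec v v).det - Real.log B.det) := by
  have hBp : B.PosDef := by
    have := Matrix.PosDef.posSemidef_add hB (Matrix.PosDef.one (n := Fin d) (R := ℝ))
    simpa using this
  have hdet := hBp.det_pos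
  have hu : IsUnit B.det := hdet.ne'.isUnit
  have h0 : 0 ≤ v ⬝ᵥ B⁻¹.mulVec v := by
    simpa using hBp.inv.posSemidef.dotProduct_mulVec_nonneg v
  set x := B⁻¹.mulVec v with hx
  have hBx : B.mulVec x = v := by
    rw [hx, Matrix.mulVec_mulVec, Matrix.mul_nonsing_inv _ hu, Matrix.one_mulVec]
  have h1 : x ⬝ᵥ x ≤ v ⬝ᵥ x := by
    have := hB.dotProduct_mulVec_nonneg x
    rw [Matrix.sub_mulVec, hBx, Matrix.one_mulVec, dotProduct_sub] at this
    simp only [star_trivial] at this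
    rw [dotProduct_comm v x]; linarith
  have hv1 : ∑ i, v i ^ 2 ≤ 1 := by
    rw [Real.sqrt_le_iff, one_pow] at hv; exact hv.2
  have h2 : (v ⬝ᵥ x) ^ 2 ≤ (∑ i, v i ^ 2) * (∑ i, x i ^ 2) :=
    Finset.sum_mul_sq_le_sq_mul_sq _ _ _
  have hxx : ∑ i, x i ^ 2 = x ⬝ᵥ x := by simp [dotProduct, sq]
  have hxn : 0 ≤ ∑ i, x i ^ 2 := Finset.sum_nonneg fun i _ => sq_nonneg _
  have h3 : v ⬝ᵥ x ≤ 1 := by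
    by_contra! h
    nlinarith
  refine ⟨h0, ?_⟩
  have hd : (B + Matrix.vecMulVec v v).det = B.det * (1 + v ⬝ᵥ x) := by
    have := Matrix.det_add_replicateCol_mul_replicateRow (ι := Unit) hu v v
    rw [Matrix.vecMulVec_eq Unit, this]
    congr 1
    rw [Matrix.det_unique]
    simp [Matrix.mul_apply, hx, dotProduct, Matrix.mulVec, Finset.mul_sum, Finset.sum_mul]
    rw [Finset.sum_comm]
    simp [mul_assoc]
  rw [hd, Real.log_mul hdet.ne' (by positivity)]
  have h4 := Real.one_sub_inv_le_log_of_pos (show 0 < 1 + v ⬝ᵥ x by positivity)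
  have h5 : v ⬝ᵥ x / 2 ≤ 1 - (1 + v ⬝ᵥ x)⁻¹ := by
    have : 1 - (1 + v ⬝ᵥ x)⁻¹ = (v ⬝ᵥ x) / (1 + v ⬝ᵥ x) := by
      field_simp; ring
    rw [this]
    apply div_le_div_of_nonneg_left h0 (by positivity) (by linarith)
  linarith

lemma aux_det {d : ℕ} (B : Matrix (Fin d) (Fin d) ℝ) (hB : B.PosDef) (s : ℝ) (hs : 0 < s)
    (ht : B.trace ≤ d * s) : Real.log B.det ≤ d * Real.log s := by
  have e1 := hB.1.det_eq_prod_eigenvalues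
  have e2 := hB.1.trace_eq_sum_eigenvalues
  simp only [RCLike.ofReal_real_eq_id, id] at e1 e2
  rw [e1, Real.log_prod (fun i _ => (hB.eigenvalues_pos i).ne')]
  have : ∀ i ∈ Finset.univ, Real.log (hB.1.eigenvalues i) ≤
      Real.log s - 1 + hB.1.eigenvalues i / s := by
    intro i _
    have hp := hB.eigenvalues_pos i
    have := Real.log_le_sub_one_of_pos (div_pos hp hs)
    rw [Real.log_div hp.ne' hs.ne'] at this
    linarith
  refine (Finset.sum_le_sum this).trans ?_
  rw [Finset.sum_add_distrib, ← Finset.sum_div, ← e2]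
  have : B.trace / s ≤ d := by rwa [div_le_iff₀ hs]
  simp
  linarith

/-- Sum of exploration bonuses (corollary of the elliptical potential lemma): with
`A_1 = λ I` and `A_{m+1} = A_m + φ_m φ_mᵀ` for unit-norm vectors `φ_m`,
`Σ_{m=1}^M √(φ_mᵀ A_m⁻¹ φ_m) ≤ √(2 M d log(1 + M/(λ d)))`. -/
theorem sum_exploration_bonuses {d M : ℕ} (hd : 1 ≤ d) (hM : 1 ≤ M)
    (lam : ℝ) (hlam : 1 ≤ lam)
    (φ : ℕ → Fin d → ℝ)
    (hφ : ∀ m ∈ Finset.Icc 1 M, Real.sqrt (∑ i, φ m i ^ 2) ≤ 1)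
    (A : ℕ → Matrix (Fin d) (Fin d) ℝ)
    (hA1 : A 1 = lam • (1 : Matrix (Fin d) (Fin d) ℝ))
    (hArec : ∀ m ∈ Finset.Icc 1 M, A (m + 1) = A m + Matrix.vecMulVec (φ m) (φ m)) :
    ∑ m ∈ Finset.Icc 1 M, Real.sqrt (φ m ⬝ᵥ (A m)⁻¹.mulVec (φ m)) ≤
      Real.sqrt (2 * M * d * Real.log (1 + M / (lam * d))) := by
  have key : ∀ m, m ≤ M → (A (m+1) - 1).PosSemidef ∧ (A (m+1)).trace ≤ lam * d + m ∧
      (∀ k ∈ Finset.Icc 1 m, 0 ≤ φ k ⬝ᵥ (A k)⁻¹.mulVec (φ k)) ∧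
      ∑ k ∈ Finset.Icc 1 m, φ k ⬝ᵥ (A k)⁻¹.mulVec (φ k) ≤
        2 * (Real.log (A (m+1)).det - d * Real.log lam) := by
    intro m
    induction m with
    | zero =>
      intro _
      have : lam • (1 : Matrix (Fin d) (Fin d) ℝ) - 1 = (lam - 1) • 1 := by
        rw [sub_smul, one_smul]
      simp only [zero_add, hA1]
      refine ⟨?_, ?_, ?_, ?_⟩
      · rw [this]
        exact Matrix.PosSemidef.one.smul (by linarith)
      · simp
      · simp
      · simp [Matrix.det_smul]
    | succ m ih =>
      intro hm
      obtain ⟨i1, i2, i3, i4⟩ := ih (by omega)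
      have hmem : m + 1 ∈ Finset.Icc 1 M := by simp; omega
      obtain ⟨s1, s2⟩ := aux_step _ i1 _ (hφ _ hmem)
      rw [hArec _ hmem]
      refine ⟨?_, ?_, ?_, ?_⟩
      · rw [add_sub_right_comm]
        refine i1.add ?_
        simpa using Matrix.posSemidef_vecMulVec_self_star (φ (m+1))
      · have := hφ _ hmem
        rw [Real.sqrt_le_iff, one_pow] at this
        replace this := this.2
        have e : (Matrix.vecMulVec (φ (m+1)) (φ (m+1))).trace = ∑ i, φ (m+1) i ^ 2 := by
          simp [Matrix.trace, Matrix.vecMulVec_apply, sq]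
        rw [Matrix.trace_add, e]
        push_cast
        linarith
      · intro k hk
        rcases eq_or_ne k (m+1) with rfl | hne
        · exact s1
        · apply i3
          simp at hk ⊢; omega
      · rw [Finset.sum_Icc_succ_top (by omega)]
        linarith
  obtain ⟨i1, i2, i3, i4⟩ := key M le_rfl
  have hp : (A (M+1)).PosDef := by
    have := Matrix.PosDef.posSemidef_add i1 (Matrix.PosDef.one (n := Fin d) (R := ℝ))
    simpa using this
  have hd' : (0:ℝ) < d := by exact_mod_cast hd
  have hl : 0 < lam := by linarith
  have hdet := aux_det _ hp (lam * (1 + M / (lam * d))) (by positivity) (by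
    have : d * (lam * (1 + M / (lam * d))) = lam * d + M := by field_simp
    rw [this]; exact i2)
  rw [Real.log_mul hl.ne' (by positivity)] at hdet
  apply Real.le_sqrt_of_sq_le
  refine (sq_sum_le_card_mul_sum_sq).trans ?_
  rw [Finset.sum_congr rfl (fun k hk => Real.sq_sqrt (i3 k hk))]
  simp only [Nat.card_Icc, Nat.add_sub_cancel]
  have : ∑ k ∈ Finset.Icc 1 M, φ k ⬝ᵥ (A k)⁻¹.mulVec (φ k) ≤
      2 * (d * Real.log (1 + M / (lam * d))) := by linarith
  calc _ ≤ (M:ℝ) * (2 * (d * Real.log (1 + M / (lam * d)))) := by gcongr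
    _ = _ := by ring
end

section
/- Norm concentration of a standard Gaussian vector: Let d ≥ 1 be an integer and let μ be the standard Gaussian measure on ℝ^d (the d-fold product of the one-dimensional Gaussian measure with mean 0 and variance 1). Then for every σ ∈ (0,1), μ({ z ∈ ℝ^d : ‖z‖₂ ≥ √d + √(2 log(1/σ)) }) ≤ σ. -/
open MeasureTheory ProbabilityTheory

lemma integral_exp_sq_gaussian (l : ℝ) :
    ∫ x, Real.exp (l * x ^ 2) ∂(gaussianReal 0 1) =
      (Real.sqrt (2 * Real.pi))⁻¹ * Real.sqrt (Real.pi / (1 / 2 - l)) := by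
  rw [integral_gaussianReal_eq_integral_smul (by norm_num), ← integral_gaussian,
    ← integral_const_mul]
  congr 1
  ext x
  simp only [gaussianPDFReal, smul_eq_mul, NNReal.coe_one, mul_one, sub_zero]
  rw [mul_assoc, ← Real.exp_add]
  congr 2
  ring

/-- Norm concentration of a standard Gaussian vector: for the standard Gaussian measure `μ`
on `ℝ^d`, `μ({z : ‖z‖₂ ≥ √d + √(2 log(1/σ))}) ≤ σ`. -/
theorem gaussian_norm_concentration (d : ℕ) (hd : 1 ≤ d)
    (μ : Measure (Fin d → ℝ))
    (hμ : μ = Measure.pi fun _ : Fin d => gaussianReal 0 1)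
    (σ : ℝ) (hσ : σ ∈ Set.Ioo (0 : ℝ) 1) :
    μ {z : Fin d → ℝ |
        Real.sqrt d + Real.sqrt (2 * Real.log (1 / σ)) ≤ Real.sqrt (∑ i, z i ^ 2)} ≤
      ENNReal.ofReal σ := by
  obtain ⟨h0, h1⟩ := hσ
  have hprob : IsProbabilityMeasure μ := by rw [hμ]; infer_instance
  have hlog : 0 < Real.log (1 / σ) := Real.log_pos (by rw [lt_div_iff₀ h0]; linarith)
  set t := Real.sqrt (2 * Real.log (1 / σ)) with ht
  have htpos : 0 ≤ t := Real.sqrt_nonneg _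
  have ht2 : t ^ 2 = 2 * Real.log (1 / σ) := Real.sq_sqrt (by positivity)
  have hσt : σ = Real.exp (-(t ^ 2 / 2)) := by
    rw [ht2, one_div, Real.log_inv, show -(2 * -Real.log σ / 2) = Real.log σ by ring,
      Real.exp_log h0]
  have hdpos : (0 : ℝ) < d := by exact_mod_cast hd
  set s := Real.sqrt d with hs
  have hspos : 0 < s := Real.sqrt_pos.2 hdpos
  have hs2 : s ^ 2 = d := Real.sq_sqrt hdpos.le
  set r := s + t with hr
  have hrpos : 0 < r := by positivity
  set l : ℝ := (1 - s ^ 2 / r ^ 2) / 2 with hl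
  have hl0 : 0 ≤ l := by
    have : s ^ 2 / r ^ 2 ≤ 1 := by
      rw [div_le_one (by positivity)]
      exact pow_le_pow_left₀ hspos.le (by linarith) 2
    simp only [hl]; linarith
  have hI : ∫ x, Real.exp (l * x ^ 2) ∂(gaussianReal 0 1) = r / s := by
    rw [integral_exp_sq_gaussian, ← Real.sqrt_inv, ← Real.sqrt_mul (by positivity),
      show (2 * Real.pi)⁻¹ * (Real.pi / (1 / 2 - l)) = (r / s) ^ 2 by
        rw [show 1 / 2 - l = s ^ 2 / (2 * r ^ 2) by simp only [hl]; field_simp; ring]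
        field_simp,
      Real.sqrt_sq (by positivity)]
  have hInt : Integrable (fun x => Real.exp (l * x ^ 2)) (gaussianReal 0 1) := by
    by_contra h
    have := integral_undef h
    rw [hI] at this
    exact (div_pos hrpos hspos).ne' this
  have hfun : (fun z : Fin d → ℝ => Real.exp (l * ∑ i, z i ^ 2)) =
      fun z => ∏ i, Real.exp (l * z i ^ 2) := by
    ext z; rw [Finset.mul_sum, Real.exp_sum]
  have hInt2 : Integrable (fun z : Fin d → ℝ => Real.exp (l * ∑ i, z i ^ 2)) μ := by
    rw [hfun, hμ]
    exact Integrable.fintype_prod (f := fun _ x => Real.exp (l * x ^ 2)) (fun _ => hInt)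
  have hmgf : mgf (fun z : Fin d → ℝ => ∑ i, z i ^ 2) μ l = (r / s) ^ d := by
    rw [mgf, hfun, hμ,
      integral_fintype_prod_eq_prod (f := fun (_ : Fin d) x => Real.exp (l * x ^ 2))]
    simp [hI, div_pow]
  have key := measure_ge_le_exp_mul_mgf (μ := μ) (r ^ 2) hl0 hInt2
  rw [hmgf] at key
  have hbound : Real.exp (-l * r ^ 2) * (r / s) ^ d ≤ σ := by
    have h2 : r / s ≤ Real.exp (t / s) := by
      have := Real.add_one_le_exp (t / s)
      have h3 : r / s = t / s + 1 := by rw [hr]; field_simp; ring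
      linarith
    calc Real.exp (-l * r ^ 2) * (r / s) ^ d
        ≤ Real.exp (-l * r ^ 2) * (Real.exp (t / s)) ^ d := by gcongr
      _ = σ := by
        rw [← Real.exp_nat_mul, ← Real.exp_add, hσt, ← hs2]
        congr 1
        have : -l * r ^ 2 = -(r ^ 2 - s ^ 2) / 2 := by
          simp only [hl]; field_simp
        rw [this, hr]
        field_simp
        ring
  have hset : {z : Fin d → ℝ | r ≤ Real.sqrt (∑ i, z i ^ 2)} =
      {z | r ^ 2 ≤ ∑ i, z i ^ 2} := by
    ext z
    exact Real.le_sqrt' hrpos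
  rw [hset, ← ofReal_measureReal]
  exact ENNReal.ofReal_le_ofReal (key.trans hbound)
end
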